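/- Let Ω = B(0,R) ⊂ ℝⁿ be an open ball and let H : closure(Ω) × ℝⁿ → ℝ be continuous, satisfy (H1), (H2) and (H3c), be convex in p for each x (H5), and be uniformly superlinear in p: inf_x H(x,p)/|p| → +∞ as |p| → ∞ (H6). Let L(x,v) = sup_{p ∈ ℝⁿ} (p·v − H(x,p)) be the Legendre transform, A_x the set of absolutely continuous curves η : [0,∞) → ℝⁿ with η(0) = x and η(s) in the closure of Ω for all s ≥ 0, and u(x) = inf_{η ∈ A_x} ∫₀^∞ e^{−s} L(η(s), −η̇(s)) ds the value function. Then u is a state-constraint viscosity solution of u(x) + H(x, Du(x)) = 0 on Ω, i.e. u is a viscosity subsolution in Ω and a viscosity supersolution on the closure of Ω. -/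

import Mathlib

open Metric Set MeasureTheory Filter
open scoped Topology NNReal RealInnerProductSpace

noncomputable section

abbrev Euc (n : ℕ) := EuclideanSpace ℝ (Fin n)

/-- `v` is a viscosity subsolution of `v + H(x, Dv) = 0` in the open set `Ω`. -/
def IsViscositySubsolutionIn {n : ℕ} (Ω : Set (Euc n)) (H : Euc n → Euc n → ℝ)
    (v : Euc n → ℝ) : Prop :=
  ∀ x ∈ Ω, ∀ φ : Euc n → ℝ, ContDiff ℝ 1 φ →
    IsLocalMaxOn (fun y => v y - φ y) Ω x → v x + H x (gradient φ x) ≤ 0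

/-- `v` is a viscosity supersolution of `v + H(x, Dv) = 0` on the closure of `Ω`. -/
def IsViscositySupersolutionOn {n : ℕ} (Ω : Set (Euc n)) (H : Euc n → Euc n → ℝ)
    (v : Euc n → ℝ) : Prop :=
  ∀ x ∈ closure Ω, ∀ φ : Euc n → ℝ, ContDiff ℝ 1 φ →
    IsLocalMinOn (fun y => v y - φ y) (closure Ω) x → 0 ≤ v x + H x (gradient φ x)

/-- `v` is a state-constraint viscosity solution on `Ω`. -/
def IsStateConstraintSolution {n : ℕ} (Ω : Set (Euc n)) (H : Euc n → Euc n → ℝ)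
    (v : Euc n → ℝ) : Prop :=
  ContinuousOn v (closure Ω) ∧ IsViscositySubsolutionIn Ω H v ∧
    IsViscositySupersolutionOn Ω H v

/-- Admissible curve/velocity pairs: `p.1` is the curve, `p.2` its (locally integrable)
velocity; the curve starts at `x`, stays in the closure of `Ω`, and has integrable cost. -/
def Curves {n : ℕ} (Ω : Set (Euc n)) (L : Euc n → Euc n → ℝ) (x : Euc n) :
    Set ((ℝ → Euc n) × (ℝ → Euc n)) :=
  {p | (∀ t : ℝ, 0 ≤ t → IntegrableOn p.2 (Icc 0 t) volume) ∧
    (∀ t : ℝ, 0 ≤ t → p.1 t = x + ∫ s in Icc (0:ℝ) t, p.2 s) ∧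
    (∀ t : ℝ, 0 ≤ t → p.1 t ∈ closure Ω) ∧
    IntegrableOn (fun s => Real.exp (-s) * L (p.1 s) (-p.2 s)) (Ioi (0:ℝ)) volume}

/-- The cost functional `J[x, η] = ∫₀^∞ e^{-s} L(η(s), -η̇(s)) ds`. -/
def costJ {n : ℕ} (L : Euc n → Euc n → ℝ) (p : (ℝ → Euc n) × (ℝ → Euc n)) : ℝ :=
  ∫ s in Ioi (0:ℝ), Real.exp (-s) * L (p.1 s) (-p.2 s)

/-- The value function `u(x) = inf_{η ∈ A_x} J[x, η]`. -/
def valueFun {n : ℕ} (Ω : Set (Euc n)) (L : Euc n → Euc n → ℝ) (x : Euc n) : ℝ :=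
  sInf (costJ L '' Curves Ω L x)

/-- The Legendre transform `L(x,v) = sup_p (p·v - H(x,p))`. -/
def legendreTransform {n : ℕ} (H : Euc n → Euc n → ℝ) (x v : Euc n) : ℝ :=
  ⨆ p : Euc n, (@inner ℝ _ _ p v - H x p)

/-! ### Integrals of translates -/

theorem integrableOn_comp_add_right {E : Type*} [NormedAddCommGroup E] {f : ℝ → E} (a : ℝ)
    (s : Set ℝ) :
    IntegrableOn (fun x => f (x + a)) ((fun x => x + a) ⁻¹' s) ↔ IntegrableOn f s :=
  (measurePreserving_add_right volume a).integrableOn_comp_preimage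
    (MeasurableEquiv.addRight a).measurableEmbedding

theorem setIntegral_comp_add_right {E : Type*} [NormedAddCommGroup E] [NormedSpace ℝ E]
    (f : ℝ → E) (a : ℝ) (s : Set ℝ) :
    ∫ x in (fun x => x + a) ⁻¹' s, f (x + a) = ∫ x in s, f x :=
  (measurePreserving_add_right volume a).setIntegral_preimage_emb
    (MeasurableEquiv.addRight a).measurableEmbedding f s

theorem setIntegral_exp_neg_Ioc {h : ℝ} (hh : 0 ≤ h) :
    ∫ s in Ioc (0 : ℝ) h, Real.exp (-s) = 1 - Real.exp (-h) := by
  rw [← intervalIntegral.integral_of_le hh]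
  have := intervalIntegral.integral_comp_neg (a := 0) (b := h) (fun x : ℝ => Real.exp x)
  rw [this, integral_exp]
  simp

theorem integrableOn_exp_neg_Ioc (h : ℝ) :
    IntegrableOn (fun s => Real.exp (-s)) (Ioc (0 : ℝ) h) :=
  ((by fun_prop : Continuous fun s : ℝ => Real.exp (-s)).integrableOn_Icc
    (a := 0) (b := h)).mono_set Ioc_subset_Icc_self

/-! ### The value function of a Lagrangian bounded below -/

section ValueFunction

variable {n : ℕ} {Ω : Set (Euc n)} {L : Euc n → Euc n → ℝ}

theorem const_mem_Curves {x : Euc n} (hx : x ∈ closure Ω) :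
    ((fun _ => x), (fun _ => 0)) ∈ Curves Ω L x := by
  refine ⟨fun t _ => integrableOn_zero, fun t _ => by simp, fun t _ => hx, ?_⟩
  simp only [neg_zero]
  exact (integrableOn_exp_neg_Ioi 0).mul_const _

theorem costJ_const (x : Euc n) : costJ L ((fun _ => x), (fun _ => 0)) = L x 0 := by
  simp only [costJ, neg_zero]
  rw [integral_mul_const, integral_exp_neg_Ioi_zero, one_mul]

theorem le_costJ {C : ℝ} (hL : ∀ x ∈ closure Ω, ∀ v, -C ≤ L x v) {x : Euc n}
    {p : (ℝ → Euc n) × (ℝ → Euc n)} (hp : p ∈ Curves Ω L x) : -C ≤ costJ L p := by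
  have h1 : ∫ s in Ioi (0 : ℝ), Real.exp (-s) * (-C) = -C := by
    rw [integral_mul_const, integral_exp_neg_Ioi_zero, one_mul]
  rw [← h1]
  refine setIntegral_mono_on ((integrableOn_exp_neg_Ioi 0).mul_const _) hp.2.2.2
    measurableSet_Ioi fun s hs => ?_
  exact mul_le_mul_of_nonneg_left (hL _ (hp.2.2.1 s (le_of_lt hs)) _) (Real.exp_pos _).le

theorem valueFun_le_costJ {C : ℝ} (hL : ∀ x ∈ closure Ω, ∀ v, -C ≤ L x v) {x : Euc n}
    {p : (ℝ → Euc n) × (ℝ → Euc n)} (hp : p ∈ Curves Ω L x) : valueFun Ω L x ≤ costJ L p := by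
  refine csInf_le ⟨-C, ?_⟩ (mem_image_of_mem _ hp)
  rintro _ ⟨q, hq, rfl⟩
  exact le_costJ hL hq

theorem le_valueFun {C : ℝ} (hL : ∀ x ∈ closure Ω, ∀ v, -C ≤ L x v) {x : Euc n}
    (hx : x ∈ closure Ω) : -C ≤ valueFun Ω L x := by
  refine le_csInf ⟨_, mem_image_of_mem _ (const_mem_Curves hx)⟩ ?_
  rintro _ ⟨q, hq, rfl⟩
  exact le_costJ hL hq

theorem valueFun_le {C : ℝ} (hL : ∀ x ∈ closure Ω, ∀ v, -C ≤ L x v) {x : Euc n}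
    (hx : x ∈ closure Ω) : valueFun Ω L x ≤ L x 0 :=
  (valueFun_le_costJ hL (const_mem_Curves hx)).trans_eq (costJ_const x)

theorem shift_mem_Curves {x : Euc n} {p : (ℝ → Euc n) × (ℝ → Euc n)} (hp : p ∈ Curves Ω L x)
    {h : ℝ} (hh : 0 ≤ h) :
    ((fun s => p.1 (s + h)), (fun s => p.2 (s + h))) ∈ Curves Ω L (p.1 h) := by
  obtain ⟨hint, hcurve, hmem, hcost⟩ := hp
  refine ⟨fun t ht => ?_, fun t ht => ?_, fun t ht => hmem _ (by positivity), ?_⟩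
  · have := (integrableOn_comp_add_right h (Icc h (t + h))).2
      ((hint (t + h) (by positivity)).mono_set (Icc_subset_Icc_left hh))
    simpa using this
  · have h1 := setIntegral_comp_add_right p.2 h (Ioc h (t + h))
    simp only [preimage_add_const_Ioc, sub_self, add_sub_cancel_right] at h1
    have h2 : Icc 0 (t + h) = Icc 0 h ∪ Ioc h (t + h) :=
      (Icc_union_Ioc_eq_Icc hh (by linarith)).symm
    have hi := hint (t + h) (by positivity)
    have h3 : ∫ s in Icc 0 (t + h), p.2 s = (∫ s in Icc 0 h, p.2 s) + ∫ s in Ioc h (t + h), p.2 s := by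
      rw [h2] at hi ⊢
      refine setIntegral_union ?_ measurableSet_Ioc hi.left_of_union hi.right_of_union
      rw [Set.disjoint_left]
      intro s hs hs'
      exact absurd hs.2 (not_le.2 hs'.1)
    rw [integral_Icc_eq_integral_Ioc (x := 0) (y := t), h1, hcurve _ (by positivity), hcurve h hh, h3,
      add_assoc]
  · have h1 := (integrableOn_comp_add_right h (Ioi h)).2
      (hcost.mono_set (Ioi_subset_Ioi hh))
    simp only [preimage_add_const_Ioi, sub_self] at h1
    refine (h1.const_mul (Real.exp h)).congr (Eventually.of_forall fun s => ?_)
    simp only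
    rw [← mul_assoc, ← Real.exp_add]
    congr 2
    ring

theorem costJ_eq_add_shift {x : Euc n} {p : (ℝ → Euc n) × (ℝ → Euc n)} (hp : p ∈ Curves Ω L x)
    {h : ℝ} (hh : 0 ≤ h) :
    costJ L p = (∫ s in Ioc 0 h, Real.exp (-s) * L (p.1 s) (-p.2 s)) +
      Real.exp (-h) * costJ L ((fun s => p.1 (s + h)), (fun s => p.2 (s + h))) := by
  obtain ⟨-, -, -, hcost⟩ := hp
  have h1 := setIntegral_comp_add_right (fun s => Real.exp (-s) * L (p.1 s) (-p.2 s)) h (Ioi h)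
  simp only [preimage_add_const_Ioi, sub_self] at h1
  simp only [costJ]
  rw [← integral_const_mul]
  have h2 : ∀ s, Real.exp (-h) * (Real.exp (-s) * L (p.1 (s + h)) (-p.2 (s + h))) =
      Real.exp (-(s + h)) * L (p.1 (s + h)) (-p.2 (s + h)) := fun s => by
    rw [← mul_assoc, ← Real.exp_add]
    congr 2
    ring
  simp only [h2]
  rw [h1, ← Ioc_union_Ioi_eq_Ioi hh] at *
  exact setIntegral_union Ioc_disjoint_Ioi_same measurableSet_Ioi hcost.left_of_union
    hcost.right_of_union

/-- Half of the dynamic programming principle: nearly optimal curves stay nearly optimal. -/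
theorem exists_curve_le_valueFun {C : ℝ} (hL : ∀ x ∈ closure Ω, ∀ v, -C ≤ L x v) {x : Euc n}
    (hx : x ∈ closure Ω) {ε h : ℝ} (hε : 0 < ε) (hh : 0 ≤ h) :
    ∃ p ∈ Curves Ω L x, (∫ s in Ioc 0 h, Real.exp (-s) * L (p.1 s) (-p.2 s)) +
      Real.exp (-h) * valueFun Ω L (p.1 h) ≤ valueFun Ω L x + ε := by
  obtain ⟨_, ⟨p, hp, rfl⟩, hlt⟩ := exists_lt_of_csInf_lt
    (⟨_, mem_image_of_mem (costJ L) (const_mem_Curves hx)⟩)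
    (show sInf (costJ L '' Curves Ω L x) < valueFun Ω L x + ε from lt_add_of_pos_right _ hε)
  refine ⟨p, hp, le_trans ?_ hlt.le⟩
  rw [costJ_eq_add_shift hp hh]
  gcongr
  exact valueFun_le_costJ hL (shift_mem_Curves hp hh)

/-- The curve running along `s ↦ x + s • w` up to time `τ`, then along `p`. -/
def lineThen (x w : Euc n) (τ : ℝ) (p : (ℝ → Euc n) × (ℝ → Euc n)) :
    (ℝ → Euc n) × (ℝ → Euc n) :=
  ((fun s => if s ≤ τ then x + s • w else p.1 (s - τ)),
    (fun s => if s ≤ τ then w else p.2 (s - τ)))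

theorem lineThen_mem_Curves {x w : Euc n} {τ : ℝ} (hτ : 0 ≤ τ)
    (hmem : ∀ s ∈ Icc 0 τ, x + s • w ∈ closure Ω)
    (hcont : ContinuousOn (fun s : ℝ => L (x + s • w) (-w)) (Icc 0 τ))
    {p : (ℝ → Euc n) × (ℝ → Euc n)} (hp : p ∈ Curves Ω L (x + τ • w)) :
    lineThen x w τ p ∈ Curves Ω L x := by
  obtain ⟨hint, hcurve, hpmem, hcost⟩ := hp
  have hleft : ∀ t, IntegrableOn (lineThen x w τ p).2 (Icc 0 (min t τ)) := fun t =>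
    (integrableOn_const (C := w) (by simp)).congr_fun (fun s hs => by
      simp [lineThen, hs.2.trans (min_le_right _ _)]) measurableSet_Icc
  have hright : ∀ t, τ ≤ t → IntegrableOn (lineThen x w τ p).2 (Ioc τ t) := fun t ht => by
    have h1 := (integrableOn_comp_add_right (-τ) (Ioc 0 (t - τ))).2
      ((hint (t - τ) (by linarith)).mono_set Ioc_subset_Icc_self)
    simp only [preimage_add_const_Ioc, sub_neg_eq_add, zero_add, sub_add_cancel] at h1
    refine h1.congr_fun (fun s hs => ?_) measurableSet_Ioc
    simp [lineThen, hs.1, sub_eq_add_neg]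
  have hlineint : ∀ t, 0 ≤ t → t ≤ τ → ∫ s in Icc 0 t, (lineThen x w τ p).2 s = t • w := by
    intro t ht htτ
    rw [setIntegral_congr_fun (g := fun _ => w) measurableSet_Icc
      (fun s hs => by simp [lineThen, hs.2.trans htτ])]
    simp [ht]
  refine ⟨fun t ht => ?_, fun t ht => ?_, fun t ht => ?_, ?_⟩
  · rcases le_total t τ with h | h
    · simpa [h] using hleft t
    · rw [← Icc_union_Ioc_eq_Icc hτ h]
      exact IntegrableOn.union (by simpa [h] using hleft t) (hright t h)
  · rcases le_or_gt t τ with h | h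
    · rw [hlineint t ht h]
      simp [lineThen, h]
    · have hd : Disjoint (Icc 0 τ) (Ioc τ t) := by
        rw [Set.disjoint_left]
        intro s hs hs'
        exact absurd hs.2 (not_le.2 hs'.1)
      rw [← Icc_union_Ioc_eq_Icc hτ h.le, setIntegral_union hd measurableSet_Ioc
        (by simpa using hleft τ) (hright t h.le), hlineint τ hτ le_rfl]
      have h1 := setIntegral_comp_add_right p.2 (-τ) (Ioc 0 (t - τ))
      simp only [preimage_add_const_Ioc, sub_neg_eq_add, zero_add, sub_add_cancel] at h1
      rw [setIntegral_congr_fun (g := fun s => p.2 (s + -τ)) measurableSet_Ioc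
        (fun s hs => by simp [lineThen, hs.1, sub_eq_add_neg]), h1, ← integral_Icc_eq_integral_Ioc,
        ← add_assoc, ← hcurve _ (by linarith)]
      simp [lineThen, h]
  · rcases le_or_gt t τ with h | h
    · simpa [lineThen, h] using hmem t ⟨ht, h⟩
    · simpa [lineThen, not_le.2 h] using hpmem (t - τ) (by linarith)
  · rw [← Ioc_union_Ioi_eq_Ioi hτ]
    refine IntegrableOn.union ?_ ?_
    · have : IntegrableOn (fun s : ℝ => Real.exp (-s) * L (x + s • w) (-w)) (Ioc 0 τ) :=
        (ContinuousOn.integrableOn_Icc ((by fun_prop : Continuous fun s : ℝ =>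
          Real.exp (-s)).continuousOn.mul hcont)).mono_set Ioc_subset_Icc_self
      exact this.congr_fun (fun s hs => by simp [lineThen, hs.2]) measurableSet_Ioc
    · have h1 := (integrableOn_comp_add_right (-τ) (Ioi 0)).2 hcost
      simp only [preimage_add_const_Ioi, sub_neg_eq_add, zero_add] at h1
      refine IntegrableOn.congr_fun (h1.const_mul (Real.exp (-τ))) (fun s hs => ?_) measurableSet_Ioi
      have hs' : ¬ s ≤ τ := not_le.2 hs
      simp only [lineThen, hs', if_false, sub_eq_add_neg]
      rw [← mul_assoc, ← Real.exp_add]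
      congr 2
      ring

theorem valueFun_le_line {C : ℝ} (hL : ∀ x ∈ closure Ω, ∀ v, -C ≤ L x v) {x w : Euc n} {τ : ℝ}
    (hτ : 0 ≤ τ) (hmem : ∀ s ∈ Icc 0 τ, x + s • w ∈ closure Ω)
    (hcont : ContinuousOn (fun s : ℝ => L (x + s • w) (-w)) (Icc 0 τ)) {B : ℝ}
    (hB : ∀ s ∈ Icc 0 τ, L (x + s • w) (-w) ≤ B) :
    valueFun Ω L x ≤
      (1 - Real.exp (-τ)) * B + Real.exp (-τ) * valueFun Ω L (x + τ • w) := by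
  have hy := hmem τ ⟨hτ, le_rfl⟩
  suffices h : ∀ p ∈ Curves Ω L (x + τ • w),
      valueFun Ω L x ≤ (1 - Real.exp (-τ)) * B + Real.exp (-τ) * costJ L p by
    rw [← sub_le_iff_le_add', ← div_le_iff₀' (Real.exp_pos _)]
    refine le_csInf ⟨_, mem_image_of_mem _ (const_mem_Curves hy)⟩ ?_
    rintro _ ⟨q, hq, rfl⟩
    rw [div_le_iff₀' (Real.exp_pos _), sub_le_iff_le_add']
    exact h q hq
  intro p hp
  have hq := lineThen_mem_Curves hτ hmem hcont hp
  refine (valueFun_le_costJ hL hq).trans ?_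
  rw [costJ_eq_add_shift hq hτ]
  have h1 : costJ L ((fun s => (lineThen x w τ p).1 (s + τ)),
      (fun s => (lineThen x w τ p).2 (s + τ))) = costJ L p := by
    refine setIntegral_congr_fun measurableSet_Ioi fun s (hs : 0 < s) => ?_
    simp [lineThen, not_le.2 hs]
  rw [h1]
  gcongr
  rw [← setIntegral_exp_neg_Ioc hτ, ← integral_mul_const]
  refine setIntegral_mono_on (hq.2.2.2.mono_set Ioc_subset_Ioi_self)
    ((integrableOn_exp_neg_Ioc τ).mul_const _) measurableSet_Ioc fun s hs => ?_
  have := hB s ⟨hs.1.le, hs.2⟩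
  simp only [lineThen, hs.2, if_true]
  gcongr

end ValueFunction

/-! ### The Legendre transform of a superlinear Hamiltonian -/

section Legendre

variable {n : ℕ} {K : Set (Euc n)} {H : Euc n → Euc n → ℝ}

theorem exists_inner_sub_le {C₁ : ℝ} (hH1 : ∀ x ∈ K, ∀ p, -H x p ≤ C₁)
    (hH6 : ∀ M : ℝ, ∃ r : ℝ, ∀ p : Euc n, r ≤ ‖p‖ → ∀ x ∈ K, M * ‖p‖ ≤ H x p) (M : ℝ) :
    ∃ B, ∀ v : Euc n, ‖v‖ ≤ M → ∀ x ∈ K, ∀ p, ⟪p, v⟫ - H x p ≤ B := by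
  obtain ⟨r, hr⟩ := hH6 M
  refine ⟨max 0 (|r| * M + C₁), fun v hv x hx p => ?_⟩
  have hin : ⟪p, v⟫ ≤ ‖p‖ * M :=
    (real_inner_le_norm p v).trans (mul_le_mul_of_nonneg_left hv (norm_nonneg _))
  rcases le_total r ‖p‖ with h | h
  · exact le_max_of_le_left (by linarith [hr p h x hx])
  · refine le_max_of_le_right ?_
    have hM : 0 ≤ M := (norm_nonneg v).trans hv
    have : ‖p‖ * M ≤ |r| * M := mul_le_mul_of_nonneg_right (h.trans (le_abs_self r)) hM
    linarith [hH1 x hx p]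

theorem inner_sub_le_legendreTransform {C₁ : ℝ} (hH1 : ∀ x ∈ K, ∀ p, -H x p ≤ C₁)
    (hH6 : ∀ M : ℝ, ∃ r : ℝ, ∀ p : Euc n, r ≤ ‖p‖ → ∀ x ∈ K, M * ‖p‖ ≤ H x p)
    {x : Euc n} (hx : x ∈ K) (p v : Euc n) : ⟪p, v⟫ - H x p ≤ legendreTransform H x v := by
  obtain ⟨B, hB⟩ := exists_inner_sub_le hH1 hH6 ‖v‖
  exact le_ciSup (f := fun p => ⟪p, v⟫ - H x p)
    ⟨B, by rintro _ ⟨q, rfl⟩; exact hB v le_rfl x hx q⟩ p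

theorem exists_legendreTransform_le {C₁ : ℝ} (hH1 : ∀ x ∈ K, ∀ p, -H x p ≤ C₁)
    (hH6 : ∀ M : ℝ, ∃ r : ℝ, ∀ p : Euc n, r ≤ ‖p‖ → ∀ x ∈ K, M * ‖p‖ ≤ H x p) (M : ℝ) :
    ∃ B, ∀ v : Euc n, ‖v‖ ≤ M → ∀ x ∈ K, legendreTransform H x v ≤ B := by
  obtain ⟨B, hB⟩ := exists_inner_sub_le hH1 hH6 M
  exact ⟨B, fun v hv x hx => ciSup_le fun p => hB v hv x hx p⟩

theorem neg_le_legendreTransform {C₁ C₂ : ℝ} (hH1 : ∀ x ∈ K, ∀ p, -H x p ≤ C₁)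
    (hH2 : ∀ x ∈ K, |H x 0| ≤ C₂)
    (hH6 : ∀ M : ℝ, ∃ r : ℝ, ∀ p : Euc n, r ≤ ‖p‖ → ∀ x ∈ K, M * ‖p‖ ≤ H x p)
    {x : Euc n} (hx : x ∈ K) (v : Euc n) : -C₂ ≤ legendreTransform H x v := by
  have := inner_sub_le_legendreTransform hH1 hH6 hx 0 v
  rw [inner_zero_left] at this
  linarith [(abs_le.1 (hH2 x hx)).2]

theorem legendreTransform_lipschitz {C₁ C₂ : ℝ} (hH1 : ∀ x ∈ K, ∀ p, -H x p ≤ C₁)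
    (hH2 : ∀ x ∈ K, |H x 0| ≤ C₂)
    (hH3 : ∀ r > (0:ℝ), ∃ C > (0:ℝ), ∀ x ∈ K, ∀ y ∈ K, ∀ p q : Euc n, ‖p‖ ≤ r → ‖q‖ ≤ r →
      |H x p - H y p| ≤ C * ‖x - y‖ ∧ |H x p - H x q| ≤ C * ‖p - q‖)
    (hH6 : ∀ M : ℝ, ∃ r : ℝ, ∀ p : Euc n, r ≤ ‖p‖ → ∀ x ∈ K, M * ‖p‖ ≤ H x p) (v : Euc n) :
    ∃ C > (0 : ℝ), ∀ x ∈ K, ∀ y ∈ K,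
      legendreTransform H x v ≤ legendreTransform H y v + C * ‖x - y‖ := by
  obtain ⟨r, hr⟩ := hH6 (‖v‖ + 1)
  set ρ := max 1 (max r C₂)
  obtain ⟨C, hC, hCH⟩ := hH3 ρ (by positivity)
  refine ⟨C, hC, fun x hx y hy => ciSup_le fun p => ?_⟩
  rcases le_total ρ ‖p‖ with h | h
  · have h1 := hr p ((le_max_left _ _).trans ((le_max_right _ _).trans h)) x hx
    have h2 : C₂ ≤ ‖p‖ := (le_max_right _ _).trans ((le_max_right _ _).trans h)
    have h3 := neg_le_legendreTransform hH1 hH2 hH6 hy v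
    have h4 := real_inner_le_norm p v
    have h5 : 0 ≤ C * ‖x - y‖ := by positivity
    nlinarith
  · have h1 := (abs_le.1 (hCH x hx y hy p p h h).1).1
    have h2 := inner_sub_le_legendreTransform hH1 hH6 hy p v
    linarith

theorem legendreTransform_superlinear {C₁ C₂ : ℝ} (hH1 : ∀ x ∈ K, ∀ p, -H x p ≤ C₁)
    (hC₂ : 0 < C₂) (hH2 : ∀ x ∈ K, |H x 0| ≤ C₂)
    (hH3 : ∀ r > (0:ℝ), ∃ C > (0:ℝ), ∀ x ∈ K, ∀ y ∈ K, ∀ p q : Euc n, ‖p‖ ≤ r → ‖q‖ ≤ r →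
      |H x p - H y p| ≤ C * ‖x - y‖ ∧ |H x p - H x q| ≤ C * ‖p - q‖)
    (hH6 : ∀ M : ℝ, ∃ r : ℝ, ∀ p : Euc n, r ≤ ‖p‖ → ∀ x ∈ K, M * ‖p‖ ≤ H x p)
    {k : ℝ} (hk : 0 < k) :
    ∃ C > (0 : ℝ), ∀ x ∈ K, ∀ v, k * ‖v‖ - C ≤ legendreTransform H x v := by
  obtain ⟨C, hC, hCH⟩ := hH3 k hk
  refine ⟨C₂ + C * k, by positivity, fun x hx v => ?_⟩
  rcases eq_or_ne v 0 with rfl | hv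
  · have h1 := neg_le_legendreTransform hH1 hH2 hH6 hx 0
    have : 0 < C * k := by positivity
    simp only [norm_zero, mul_zero]
    linarith
  · have hv' : ‖v‖ ≠ 0 := norm_ne_zero_iff.2 hv
    set p : Euc n := (k / ‖v‖) • v
    have hp : ‖p‖ = k := by
      rw [norm_smul, norm_div, norm_norm, Real.norm_of_nonneg hk.le, div_mul_cancel₀ _ hv']
    have h1 := inner_sub_le_legendreTransform hH1 hH6 hx p v
    have h2 : ⟪p, v⟫ = k * ‖v‖ := by
      rw [real_inner_smul_left, real_inner_self_eq_norm_sq]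
      field_simp
    have h3 := (abs_le.1 (hCH x hx x hx p 0 hp.le (by simp [hk.le])).2).2
    rw [sub_zero, hp] at h3
    linarith [(abs_le.1 (hH2 x hx)).2]

/-- Approximate form of the Fenchel–Moreau duality `H = L*`. -/
theorem exists_legendreTransform_le_inner_sub {x : Euc n} (hconv : ConvexOn ℝ univ (H x))
    {q : Euc n} {a : ℝ} (ha : a < H x q) :
    ∃ v, legendreTransform H x v ≤ ⟪q, v⟫ - a := by
  have hcont : Continuous (H x) := hconv.locallyLipschitz.continuous
  obtain ⟨l, c, hle, heq⟩ := hconv.exists_affine_le_of_lt (𝕜 := ℝ) (mem_univ q) ha isClosed_univ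
    (hcont.lowerSemicontinuous.lowerSemicontinuousOn _)
  set v := (InnerProductSpace.toDual ℝ (Euc n)).symm l
  have hv : ∀ p, l p = ⟪p, v⟫ := fun p => by
    rw [real_inner_comm, InnerProductSpace.toDual_symm_apply]
  refine ⟨v, ciSup_le fun p => ?_⟩
  have h1 := hle ⟨p, mem_univ p⟩
  simp [hv] at h1 heq
  linarith

end Legendre

/-! ### Regularity and viscosity inequalities for the value function -/

section Viscosity

variable {n : ℕ} {Ω : Set (Euc n)} {L : Euc n → Euc n → ℝ}

theorem valueFun_sub_le {B C : ℝ} (hΩ : Convex ℝ (closure Ω))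
    (hL : ∀ x ∈ closure Ω, ∀ v, -C ≤ L x v)
    (hLcont : ∀ v, ContinuousOn (fun x => L x v) (closure Ω))
    (hB : ∀ v, ‖v‖ ≤ 1 → ∀ x ∈ closure Ω, L x v ≤ B) {x y : Euc n}
    (hx : x ∈ closure Ω) (hy : y ∈ closure Ω) :
    valueFun Ω L x - valueFun Ω L y ≤ (B + C) * ‖y - x‖ := by
  rcases eq_or_ne y x with rfl | hne
  · simp
  have hτ : 0 < ‖y - x‖ := norm_pos_iff.2 (sub_ne_zero.2 hne)
  set τ := ‖y - x‖ with hτdef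
  set w := τ⁻¹ • (y - x) with hw
  have hwn : ‖-w‖ = 1 := by
    rw [norm_neg, norm_smul, norm_inv, norm_norm, inv_mul_cancel₀ hτ.ne']
  have hend : x + τ • w = y := by
    rw [hw, smul_inv_smul₀ hτ.ne', add_sub_cancel]
  have hmem : ∀ s ∈ Icc 0 τ, x + s • w ∈ closure Ω := fun s hs => by
    have := hΩ.add_smul_sub_mem hx hy (t := s / τ)
      ⟨div_nonneg hs.1 hτ.le, (div_le_one hτ).2 hs.2⟩
    rwa [div_eq_mul_inv, mul_smul] at this
  have h1 := valueFun_le_line hL hτ.le hmem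
    ((hLcont (-w)).comp (by fun_prop) hmem) (fun s hs => hB (-w) hwn.le _ (hmem s hs))
  rw [hend] at h1
  have h2 := le_valueFun hL hy
  have h3 : 1 - Real.exp (-τ) ≤ τ := by linarith [Real.add_one_le_exp (-τ)]
  have h4 : 0 ≤ 1 - Real.exp (-τ) := by
    linarith [Real.exp_le_one_iff.2 (neg_nonpos.2 hτ.le)]
  have h5 : 0 ≤ B + C := by linarith [hL x hx (-w), hB (-w) hwn.le x hx]
  nlinarith

theorem valueFun_le_sub_inner {C : ℝ} (hΩ : IsOpen Ω)
    (hL : ∀ x ∈ closure Ω, ∀ v, -C ≤ L x v)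
    {v : Euc n} {A : ℝ} (hA : ∀ x ∈ closure Ω, ∀ y ∈ closure Ω, L x v ≤ L y v + A * ‖x - y‖)
    (hLcont : ContinuousOn (fun x => L x v) (closure Ω))
    {x : Euc n} (hx : x ∈ Ω) {φ : Euc n → ℝ} (hφ : DifferentiableAt ℝ φ x)
    (hmax : IsLocalMaxOn (fun y => valueFun Ω L y - φ y) Ω x) (hA0 : 0 ≤ A) :
    valueFun Ω L x ≤ L x v - ⟪gradient φ x, v⟫ := by
  obtain ⟨r, hr, hball⟩ := Metric.mem_nhds_iff.1
    ((hmax.isLocalMax (hΩ.mem_nhds hx)).and (hΩ.mem_nhds hx))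
  have hlim1 : Tendsto (fun h : ℝ => h⁻¹ • (Real.exp (0 + h) - Real.exp 0) *
      (valueFun Ω L x - L x v - A * (h * ‖v‖))) (𝓝[>] 0)
      (𝓝 (Real.exp 0 * (valueFun Ω L x - L x v - A * (0 * ‖v‖)))) := by
    refine (Real.hasDerivAt_exp 0).tendsto_slope_zero_right.mul ?_
    exact ((by fun_prop : Continuous fun h : ℝ =>
      valueFun Ω L x - L x v - A * (h * ‖v‖)).tendsto 0).mono_left nhdsWithin_le_nhds
  have hderiv : HasDerivAt (fun h : ℝ => φ (x + h • (-v))) ⟪gradient φ x, -v⟫ 0 := by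
    have h1 : HasFDerivAt φ (InnerProductSpace.toDual ℝ (Euc n) (gradient φ x))
        (x + (0 : ℝ) • (-v)) := by
      simpa using hφ.hasGradientAt.hasFDerivAt
    have h2 : HasDerivAt (fun h : ℝ => x + h • (-v)) (-v) 0 := by
      simpa using ((hasDerivAt_id (0 : ℝ)).smul_const (-v)).const_add x
    exact h1.comp_hasDerivAt 0 h2
  have hlim2 := hderiv.tendsto_slope_zero_right
  have hev : ∀ᶠ h : ℝ in 𝓝[>] 0, h * ‖v‖ < r := by
    have : Tendsto (fun h : ℝ => h * ‖v‖) (𝓝[>] 0) (𝓝 (0 * ‖v‖)) :=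
      ((by fun_prop : Continuous fun h : ℝ => h * ‖v‖).tendsto 0).mono_left nhdsWithin_le_nhds
    exact this.eventually (gt_mem_nhds (by simpa using hr))
  have key := le_of_tendsto_of_tendsto hlim1 hlim2 (by
    filter_upwards [hev, self_mem_nhdsWithin] with h hhr (hh : 0 < h)
    have hin : ∀ s ∈ Icc 0 h, x + s • (-v) ∈ ball x r := fun s hs => by
      rw [mem_ball_iff_norm, add_sub_cancel_left, norm_smul, norm_neg, Real.norm_of_nonneg hs.1]
      exact (mul_le_mul_of_nonneg_right hs.2 (norm_nonneg v)).trans_lt hhr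
    have hmem : ∀ s ∈ Icc 0 h, x + s • (-v) ∈ closure Ω := fun s hs =>
      subset_closure (hball (hin s hs)).2
    have hbound : ∀ s ∈ Icc 0 h, L (x + s • (-v)) (-(-v)) ≤ L x v + A * (h * ‖v‖) := by
      intro s hs
      rw [neg_neg]
      refine (hA _ (hmem s hs) x (subset_closure hx)).trans ?_
      rw [add_sub_cancel_left, norm_smul, norm_neg, Real.norm_of_nonneg hs.1]
      gcongr
      exact hs.2
    have h1 := valueFun_le_line hL hh.le hmem
      (by simpa only [neg_neg, Function.comp_def] using
        hLcont.comp (f := fun s : ℝ => x + s • (-v)) (by fun_prop) hmem) hbound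
    have h2 : valueFun Ω L (x + h • (-v)) - φ (x + h • (-v)) ≤ valueFun Ω L x - φ x :=
      (hball (hin h ⟨hh.le, le_rfl⟩)).1
    have h3 : Real.exp (-h) * Real.exp h = 1 := by rw [← Real.exp_add]; simp
    have h4 : (Real.exp h - 1) * (valueFun Ω L x - L x v - A * (h * ‖v‖)) ≤
        φ (x + h • (-v)) - φ x := by
      refine le_of_mul_le_mul_left ?_ (Real.exp_pos (-h))
      have h5 := mul_le_mul_of_nonneg_left h2 (Real.exp_pos (-h)).le
      linear_combination h1 + h5 + (valueFun Ω L x - L x v - A * (h * ‖v‖)) * h3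
    simp only [zero_add, Real.exp_zero, smul_eq_mul, zero_smul, add_zero]
    rw [mul_assoc]
    exact mul_le_mul_of_nonneg_left h4 (inv_nonneg.2 hh.le))
  simp only [Real.exp_zero, one_mul, zero_mul, mul_zero, sub_zero, inner_neg_right] at key
  linarith

theorem norm_sub_le_integral_norm {x : Euc n} {p : (ℝ → Euc n) × (ℝ → Euc n)}
    (hp : p ∈ Curves Ω L x) {s h : ℝ} (hs : 0 ≤ s) (hsh : s ≤ h) :
    ‖p.1 s - x‖ ≤ ∫ t in Ioc 0 h, ‖p.2 t‖ := by
  rw [hp.2.1 s hs, add_sub_cancel_left]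
  refine (norm_integral_le_integral_norm _).trans ?_
  rw [integral_Icc_eq_integral_Ioc]
  exact setIntegral_mono_set (((hp.1 h (hs.trans hsh)).mono_set Ioc_subset_Icc_self).norm)
    (Eventually.of_forall fun _ => norm_nonneg _) (Ioc_subset_Ioc_right hsh).eventuallyLE

/-- Nearly optimal curves have bounded mean speed on short time intervals. -/
theorem exists_integral_norm_le {B C M : ℝ} (hM : 0 ≤ M)
    (hL : ∀ x ∈ closure Ω, ∀ v, -C ≤ L x v) (hB : ∀ x ∈ closure Ω, L x 0 ≤ B)
    (hsup : ∀ k > (0 : ℝ), ∃ D > (0 : ℝ), ∀ x ∈ closure Ω, ∀ v, k * ‖v‖ - D ≤ L x v)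
    (hlip : ∀ x ∈ closure Ω, ∀ y ∈ closure Ω,
      valueFun Ω L x - valueFun Ω L y ≤ M * ‖y - x‖) :
    ∃ A > (0 : ℝ), ∀ x ∈ closure Ω, ∀ h, 0 ≤ h → h ≤ 1 → ∀ p ∈ Curves Ω L x,
      (∫ s in Ioc 0 h, Real.exp (-s) * L (p.1 s) (-p.2 s)) +
        Real.exp (-h) * valueFun Ω L (p.1 h) ≤ valueFun Ω L x + h →
      ∫ s in Ioc 0 h, ‖p.2 s‖ ≤ A * h := by
  obtain ⟨D, hD, hDL⟩ := hsup (Real.exp 1 * (M + 1)) (by positivity)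
  refine ⟨D + |B| + 1, by positivity, fun x hx h hh h1 p hp hle => ?_⟩
  set V := ∫ s in Ioc 0 h, ‖p.2 s‖ with hV
  have hint : IntegrableOn (fun s => ‖p.2 s‖) (Ioc 0 h) :=
    ((hp.1 h hh).mono_set Ioc_subset_Icc_self).norm
  have hlow : (M + 1) * V - D * h ≤ ∫ s in Ioc 0 h, Real.exp (-s) * L (p.1 s) (-p.2 s) := by
    have : (M + 1) * V - D * h = ∫ s in Ioc 0 h, ((M + 1) * ‖p.2 s‖ - D) := by
      rw [integral_sub (hint.const_mul _) (integrableOn_const (by simp)), integral_const_mul]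
      simp [hh, mul_comm, hV]
    rw [this]
    refine setIntegral_mono_on ((hint.const_mul _).sub (integrableOn_const (by simp)))
      (hp.2.2.2.mono_set Ioc_subset_Ioi_self) measurableSet_Ioc fun s hs => ?_
    have e1 : 1 ≤ Real.exp (-s) * Real.exp 1 := by
      rw [← Real.exp_add]
      exact Real.one_le_exp (by linarith [hs.2])
    have e2 : Real.exp (-s) ≤ 1 := Real.exp_le_one_iff.2 (by linarith [hs.1])
    have e3 := mul_le_mul_of_nonneg_left (hDL _ (hp.2.2.1 s hs.1.le) (-p.2 s)) (Real.exp_pos (-s)).le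
    rw [norm_neg] at e3
    have e4 : 0 ≤ (M + 1) * ‖p.2 s‖ := by positivity
    nlinarith
  have hy := hp.2.2.1 h hh
  have h2 := hlip x hx _ hy
  have h3 := norm_sub_le_integral_norm hp hh le_rfl
  have h4 := mul_le_mul_of_nonneg_left h3 hM
  have h5 := (valueFun_le hL hy).trans ((hB _ hy).trans (le_abs_self B))
  have h6 : 1 - Real.exp (-h) ≤ h := by linarith [Real.add_one_le_exp (-h)]
  have h7 : 0 ≤ 1 - Real.exp (-h) := by linarith [Real.exp_le_one_iff.2 (neg_nonpos.2 hh)]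
  have h8 : (1 - Real.exp (-h)) * valueFun Ω L (p.1 h) ≤ h * |B| :=
    (mul_le_mul_of_nonneg_left h5 h7).trans (mul_le_mul_of_nonneg_right h6 (abs_nonneg B))
  linarith

/-- Lower bound for the running cost of a curve of small length, obtained by freezing the
Hamiltonian at the initial point and using the Fenchel inequality. -/
theorem le_integral_cost {H : Euc n → Euc n → ℝ} {q : Euc n} {c A h : ℝ}
    (hFen : ∀ x ∈ closure Ω, ∀ v, ⟪q, v⟫ - H x q ≤ L x v)
    (hc : 0 ≤ c) (hHlip : ∀ x ∈ closure Ω, ∀ y ∈ closure Ω, |H x q - H y q| ≤ c * ‖x - y‖)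
    {x : Euc n} (hx : x ∈ closure Ω) (hh : 0 ≤ h)
    {p : (ℝ → Euc n) × (ℝ → Euc n)} (hp : p ∈ Curves Ω L x)
    (hA : ∫ s in Ioc 0 h, ‖p.2 s‖ ≤ A * h) :
    -⟪q, p.1 h - x⟫ - h * ‖q‖ * (A * h) - (1 - Real.exp (-h)) * (H x q + c * (A * h)) ≤
      ∫ s in Ioc 0 h, Real.exp (-s) * L (p.1 s) (-p.2 s) := by
  have hint2 : IntegrableOn p.2 (Ioc 0 h) := (hp.1 h hh).mono_set Ioc_subset_Icc_self
  have hinner : IntegrableOn (fun s => ⟪q, p.2 s⟫) (Ioc 0 h) := hint2.const_inner q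
  have hnorm : IntegrableOn (fun s => h * ‖q‖ * ‖p.2 s‖) (Ioc 0 h) := hint2.norm.const_mul _
  have hneg : IntegrableOn (fun s => -⟪q, p.2 s⟫) (Ioc 0 h) := hinner.neg
  have hdiff : IntegrableOn (fun s => -⟪q, p.2 s⟫ - h * ‖q‖ * ‖p.2 s‖) (Ioc 0 h) := hneg.sub hnorm
  have hexp : IntegrableOn (fun s => Real.exp (-s) * (H x q + c * (A * h))) (Ioc 0 h) :=
    (integrableOn_exp_neg_Ioc h).mul_const _
  have h1 : ∫ s in Ioc 0 h, ⟪q, p.2 s⟫ = ⟪q, p.1 h - x⟫ := by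
    rw [hp.2.1 h hh, add_sub_cancel_left, integral_Icc_eq_integral_Ioc]
    exact integral_inner hint2 q
  have h2 : ∫ s in Ioc 0 h, (-⟪q, p.2 s⟫ - h * ‖q‖ * ‖p.2 s‖ -
        Real.exp (-s) * (H x q + c * (A * h))) =
      -⟪q, p.1 h - x⟫ - h * ‖q‖ * (∫ s in Ioc 0 h, ‖p.2 s‖) -
        (1 - Real.exp (-h)) * (H x q + c * (A * h)) := by
    rw [integral_sub hdiff hexp, integral_sub hneg hnorm, integral_neg, h1,
      integral_const_mul, integral_mul_const, setIntegral_exp_neg_Ioc hh]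
  have h3 : h * ‖q‖ * (∫ s in Ioc 0 h, ‖p.2 s‖) ≤ h * ‖q‖ * (A * h) := by gcongr
  have h4 : ∫ s in Ioc 0 h, (-⟪q, p.2 s⟫ - h * ‖q‖ * ‖p.2 s‖ -
        Real.exp (-s) * (H x q + c * (A * h))) ≤
      ∫ s in Ioc 0 h, Real.exp (-s) * L (p.1 s) (-p.2 s) := by
    refine setIntegral_mono_on (hdiff.sub hexp)
      (hp.2.2.2.mono_set Ioc_subset_Ioi_self) measurableSet_Ioc fun s hs => ?_
    have hy := hp.2.2.1 s hs.1.le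
    have e1 := hFen _ hy (-p.2 s)
    rw [inner_neg_right] at e1
    have e2 := (abs_le.1 (hHlip _ hy x hx)).2
    have e3 := mul_le_mul_of_nonneg_left
      ((norm_sub_le_integral_norm hp hs.1.le hs.2).trans hA) hc
    have e4 : -⟪q, p.2 s⟫ - (H x q + c * (A * h)) ≤ L (p.1 s) (-p.2 s) := by linarith
    have e5 := mul_le_mul_of_nonneg_left e4 (Real.exp_pos (-s)).le
    have e6 : (1 - Real.exp (-s)) * -⟪q, p.2 s⟫ ≤ h * (‖q‖ * ‖p.2 s‖) := by
      have e7 : 1 - Real.exp (-s) ≤ h := by linarith [Real.add_one_le_exp (-s), hs.2]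
      have e8 : 0 ≤ 1 - Real.exp (-s) := by
        linarith [Real.exp_le_one_iff.2 (neg_nonpos.2 hs.1.le)]
      have e9 : -⟪q, p.2 s⟫ ≤ ‖q‖ * ‖p.2 s‖ :=
        (neg_le_abs _).trans (abs_real_inner_le_norm q (p.2 s))
      exact (mul_le_mul_of_nonneg_left e9 e8).trans
        (mul_le_mul_of_nonneg_right e7 (by positivity))
    linarith
  linarith

theorem valueFun_add_nonneg {H : Euc n → Euc n → ℝ} {B C M c : ℝ} (hM : 0 ≤ M)
    (hL : ∀ x ∈ closure Ω, ∀ v, -C ≤ L x v) (hB : ∀ x ∈ closure Ω, L x 0 ≤ B)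
    (hsup : ∀ k > (0 : ℝ), ∃ D > (0 : ℝ), ∀ x ∈ closure Ω, ∀ v, k * ‖v‖ - D ≤ L x v)
    (hlip : ∀ x ∈ closure Ω, ∀ y ∈ closure Ω,
      valueFun Ω L x - valueFun Ω L y ≤ M * ‖y - x‖)
    {x : Euc n} (hx : x ∈ closure Ω) {φ : Euc n → ℝ} (hφ : DifferentiableAt ℝ φ x)
    (hmin : IsLocalMinOn (fun y => valueFun Ω L y - φ y) (closure Ω) x)
    (hFen : ∀ y ∈ closure Ω, ∀ v, ⟪gradient φ x, v⟫ - H y (gradient φ x) ≤ L y v) (hc : 0 ≤ c)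
    (hHlip : ∀ y ∈ closure Ω, ∀ z ∈ closure Ω,
      |H y (gradient φ x) - H z (gradient φ x)| ≤ c * ‖y - z‖) :
    0 ≤ valueFun Ω L x + H x (gradient φ x) := by
  obtain ⟨A, hA, hspeed⟩ := exists_integral_norm_le hM hL hB hsup hlip
  set q := gradient φ x
  by_contra! hneg
  set m := -(valueFun Ω L x + H x q) with hm
  have hm0 : 0 < m := neg_pos.2 hneg
  set δ := m / (8 * A) with hδ
  have hδ0 : 0 < δ := by positivity
  have hδA : δ * A = m / 8 := by rw [hδ]; field_simp
  have hgrad := hφ.hasGradientAt.hasFDerivAt.isLittleO.def hδ0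
  obtain ⟨r, hr, hball⟩ := Metric.mem_nhds_iff.1 (hgrad.and (eventually_nhdsWithin_iff.1 hmin))
  set E := (M + c) * A + 1 + ‖q‖ * A with hE
  have hE0 : 0 < E := by positivity
  set h := min 1 (min (r / (2 * A)) (m / (8 * E))) with hhdef
  have hh : 0 < h := by positivity
  have hh1 : h ≤ 1 := min_le_left _ _
  have hAh : A * h < r := by
    have : h ≤ r / (2 * A) := (min_le_right _ _).trans (min_le_left _ _)
    rw [le_div_iff₀ (by positivity)] at this
    linarith
  have hEh : E * h ≤ m / 8 := by
    have : h ≤ m / (8 * E) := (min_le_right _ _).trans (min_le_right _ _)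
    rw [le_div_iff₀ (by positivity)] at this
    linarith
  obtain ⟨p, hp, hpε⟩ := exists_curve_le_valueFun hL hx (pow_pos hh 2) hh.le
  have hV := hspeed x hx h hh.le hh1 p hp (hpε.trans (by nlinarith))
  have hlow := le_integral_cost hFen hc hHlip hx hh.le hp hV
  have hy := hp.2.2.1 h hh.le
  have hdist : ‖p.1 h - x‖ ≤ A * h := (norm_sub_le_integral_norm hp hh.le le_rfl).trans hV
  obtain ⟨hg, hmin'⟩ := hball (mem_ball_iff_norm.2 (hdist.trans_lt hAh))
  have hmin'' := hmin' hy
  simp only [InnerProductSpace.toDual_apply_apply, Real.norm_eq_abs] at hg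
  have hg' := (abs_le.1 hg).1
  have hg'' := mul_le_mul_of_nonneg_left hdist hδ0.le
  have hlip' := hlip _ hy x hx
  rw [norm_sub_rev] at hlip'
  have hlip'' := mul_le_mul_of_nonneg_left hdist hM
  have h0 : 0 ≤ 1 - Real.exp (-h) := by linarith [Real.exp_le_one_iff.2 (neg_nonpos.2 hh.le)]
  have h1 : 1 - Real.exp (-h) ≤ h := by linarith [Real.add_one_le_exp (-h)]
  have h2 : h / 2 ≤ 1 - Real.exp (-h) := by
    have e1 : Real.exp (-h) * Real.exp h = 1 := by rw [← Real.exp_add]; simp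
    have e2 := mul_le_mul_of_nonneg_left (Real.add_one_le_exp h) (Real.exp_pos (-h)).le
    nlinarith [Real.exp_pos (-h)]
  have hu : valueFun Ω L (p.1 h) ≤ valueFun Ω L x + M * (A * h) := by linarith
  have hu' := mul_le_mul_of_nonneg_left hu h0
  have hmain : (1 - Real.exp (-h)) * m ≤
      (1 - Real.exp (-h)) * ((M + c) * (A * h)) + δ * (A * h) + h ^ 2 + h * ‖q‖ * (A * h) := by
    rw [hm]
    linarith
  have h3 : (1 - Real.exp (-h)) * ((M + c) * (A * h)) ≤ h * ((M + c) * (A * h)) := by gcongr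
  have h4 : h / 2 * m ≤ (1 - Real.exp (-h)) * m := mul_le_mul_of_nonneg_right h2 hm0.le
  have h5 : h * (m / 2) ≤ h * (m / 8 + m / 8) := by
    calc h * (m / 2) ≤ h * (E * h + δ * A) := by rw [hE]; linarith
      _ ≤ h * (m / 8 + m / 8) := by rw [hδA]; gcongr
  have := le_of_mul_le_mul_left h5 hh
  linarith

end Viscosity

/-- Theorem 5.4: the value function is a state-constraint viscosity solution of
`u + H(x, Du) = 0` on the ball. -/
theorem value_function_is_solution {n : ℕ} (R : ℝ) (hR : 0 < R)
    (H : Euc n → Euc n → ℝ)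
    (hHcont : ContinuousOn (Function.uncurry H)
      (closure (ball (0 : Euc n) R) ×ˢ (univ : Set (Euc n))))
    (C₁ : ℝ) (hC₁ : 0 < C₁) (hH1 : ∀ x ∈ closure (ball (0 : Euc n) R), ∀ p : Euc n, -H x p ≤ C₁)
    (C₂ : ℝ) (hC₂ : 0 < C₂) (hH2 : ∀ x ∈ closure (ball (0 : Euc n) R), |H x 0| ≤ C₂)
    (hH3c : ∀ r > (0:ℝ), ∃ C > (0:ℝ), ∀ x ∈ closure (ball (0 : Euc n) R),
      ∀ y ∈ closure (ball (0 : Euc n) R), ∀ p q : Euc n, ‖p‖ ≤ r → ‖q‖ ≤ r →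
        |H x p - H y p| ≤ C * ‖x - y‖ ∧ |H x p - H x q| ≤ C * ‖p - q‖)
    (hH5 : ∀ x : Euc n, ConvexOn ℝ univ (H x))
    (hH6 : ∀ M : ℝ, ∃ r : ℝ, ∀ p : Euc n, r ≤ ‖p‖ →
      ∀ x ∈ closure (ball (0 : Euc n) R), M * ‖p‖ ≤ H x p) :
    IsStateConstraintSolution (ball (0 : Euc n) R) H
      (valueFun (ball (0 : Euc n) R) (legendreTransform H)) := by
  have hconv : Convex ℝ (closure (ball (0 : Euc n) R)) := (convex_ball _ _).closure
  set Ω := ball (0 : Euc n) R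
  set L := legendreTransform H
  have hL : ∀ x ∈ closure Ω, ∀ v, -C₂ ≤ L x v := fun x hx v =>
    neg_le_legendreTransform hH1 hH2 hH6 hx v
  have hLlip := legendreTransform_lipschitz hH1 hH2 hH3c hH6
  have hLcont : ∀ v, ContinuousOn (fun x => L x v) (closure Ω) := fun v => by
    obtain ⟨C, hC, hCL⟩ := hLlip v
    refine (LipschitzOnWith.of_le_add_mul C.toNNReal fun x hx y hy => ?_).continuousOn
    rw [Real.coe_toNNReal _ hC.le, dist_eq_norm]
    exact hCL x hx y hy
  obtain ⟨B, hB⟩ := exists_legendreTransform_le hH1 hH6 1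
  have hB0 : ∀ x ∈ closure Ω, L x 0 ≤ B := hB 0 (by simp)
  have hBC : 0 ≤ B + C₂ := by
    have h0 : (0 : Euc n) ∈ closure Ω := subset_closure (mem_ball_self hR)
    linarith [hL 0 h0 0, hB0 0 h0]
  have hlip : ∀ x ∈ closure Ω, ∀ y ∈ closure Ω,
      valueFun Ω L x - valueFun Ω L y ≤ (B + C₂) * ‖y - x‖ := fun x hx y hy =>
    valueFun_sub_le hconv hL hLcont hB hx hy
  refine ⟨?_, fun x hx φ hφ hmax => ?_, fun x hx φ hφ hmin => ?_⟩
  · refine (LipschitzOnWith.of_le_add_mul (B + C₂).toNNReal fun x hx y hy => ?_).continuousOn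
    rw [Real.coe_toNNReal _ hBC, dist_comm, dist_eq_norm]
    linarith [hlip x hx y hy]
  · have hφd := (hφ.differentiable one_ne_zero) x
    by_contra! hpos
    obtain ⟨v, hv⟩ := exists_legendreTransform_le_inner_sub (hH5 x)
      (show (H x (gradient φ x) - valueFun Ω L x) / 2 < H x (gradient φ x) by linarith)
    obtain ⟨A, hA, hAL⟩ := hLlip v
    have := valueFun_le_sub_inner isOpen_ball hL hAL (hLcont v) hx hφd hmax hA.le
    linarith
  · obtain ⟨c, hc, hcH⟩ := hH3c (max 1 ‖gradient φ x‖) (by positivity)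
    exact valueFun_add_nonneg hBC hL hB0
      (fun k hk => legendreTransform_superlinear hH1 hC₂ hH2 hH3c hH6 hk) hlip hx
      ((hφ.differentiable one_ne_zero) x) hmin
      (fun y hy v => inner_sub_le_legendreTransform hH1 hH6 hy _ v) hc.le
      (fun y hy z hz => (hcH y hy z hz _ _ (le_max_right _ _) (le_max_right _ _)).1)
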